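/- arXiv:2307.07320 — 3 statements merged into one kernel-verified Lean document; each statement's English description precedes it below -/
import Mathlib

section
/- For every β > 0, the function f(x) = (β (log 2)^β)^{1/2} · {x · log(e²x) · (log log(e²x))^{1+β}}^{−1/2}, defined on [1,∞), is positive and decreasing and satisfies ∫₁^∞ f²(x) dx = 1 and ∫₁^∞ f(x) dx = ∞. -/
open MeasureTheory

open Filter Topology in
/-- For every `β > 0`, the function
`f(x) = (β (log 2)^β)^{1/2} · {x · log(e²x) · (log log(e²x))^{1+β}}^{−1/2}` on `[1,∞)`
is positive and decreasing, `∫₁^∞ f² = 1`, and `∫₁^∞ f = ∞` (i.e. `f` is not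
integrable on `(1,∞)`). -/
theorem stmt6 (β : ℝ) (hβ : 0 < β) (f : ℝ → ℝ)
    (hf : ∀ u, f u =
      Real.sqrt (β * Real.log 2 ^ β) /
        Real.sqrt (u * Real.log (Real.exp 2 * u) *
          Real.log (Real.log (Real.exp 2 * u)) ^ (1 + β))) :
    (∀ u ∈ Set.Ici (1 : ℝ), 0 < f u) ∧
    StrictAntiOn f (Set.Ici 1) ∧
    (∫ u in Set.Ioi (1 : ℝ), (f u) ^ 2) = 1 ∧
    ¬ IntegrableOn f (Set.Ioi 1) := by
  have hlog2 : 0 < Real.log 2 := Real.log_pos one_lt_two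
  have hK : 0 < β * Real.log 2 ^ β := by positivity
  have hL : ∀ u : ℝ, 1 ≤ u → 2 ≤ Real.log (Real.exp 2 * u) := fun u hu => by
    rw [Real.log_mul (Real.exp_pos 2).ne' (by positivity), Real.log_exp]
    linarith [Real.log_nonneg hu]
  have hM : ∀ u : ℝ, 1 ≤ u → 0 < Real.log (Real.log (Real.exp 2 * u)) := fun u hu =>
    Real.log_pos (by linarith [hL u hu])
  have hG : ∀ u : ℝ, 1 ≤ u → 0 < u * Real.log (Real.exp 2 * u) *
      Real.log (Real.log (Real.exp 2 * u)) ^ (1 + β) := fun u hu => by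
    have := hL u hu
    have := hM u hu
    positivity
  have hpos : ∀ u ∈ Set.Ici (1 : ℝ), 0 < f u := fun u hu => by
    rw [hf]
    exact div_pos (Real.sqrt_pos.2 hK) (Real.sqrt_pos.2 (hG u hu))
  have htop : Tendsto (fun u : ℝ => Real.exp 2 * u) atTop atTop :=
    tendsto_id.const_mul_atTop (Real.exp_pos 2)
  have hLtop : Tendsto (fun u : ℝ => Real.log (Real.exp 2 * u)) atTop atTop :=
    Real.tendsto_log_atTop.comp htop
  refine ⟨hpos, ?_, ?_, ?_⟩
  · intro a ha b hb hab
    rw [Set.mem_Ici] at ha hb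
    rw [hf, hf]
    have h2 := hL a ha
    have h3 := hM a ha
    have h4 : Real.log (Real.exp 2 * a) ≤ Real.log (Real.exp 2 * b) := by gcongr
    refine div_lt_div_of_pos_left (Real.sqrt_pos.2 hK) (Real.sqrt_pos.2 (hG a ha))
      (Real.sqrt_lt_sqrt (hG a ha).le ?_)
    have h5 : Real.log (Real.log (Real.exp 2 * a)) ≤ Real.log (Real.log (Real.exp 2 * b)) := by
      gcongr
    have h6 : 0 < Real.log (Real.log (Real.exp 2 * a)) ^ (1 + β) := by positivity
    have h7 : a * Real.log (Real.exp 2 * a) < b * Real.log (Real.exp 2 * b) := by nlinarith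
    calc _ < b * Real.log (Real.exp 2 * b) *
          Real.log (Real.log (Real.exp 2 * a)) ^ (1 + β) := by gcongr
      _ ≤ _ := by
        have : 0 ≤ b * Real.log (Real.exp 2 * b) := by nlinarith
        gcongr
  · have hderiv : ∀ u ∈ Set.Ici (1 : ℝ), HasDerivAt
        (fun u => -Real.log 2 ^ β * Real.log (Real.log (Real.exp 2 * u)) ^ (-β))
        ((f u) ^ 2) u := by
      intro u hu
      rw [Set.mem_Ici] at hu
      have h2 := hL u hu
      have h3 := hM u hu
      have h0 : HasDerivAt (fun u : ℝ => Real.exp 2 * u) (Real.exp 2) u := by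
        simpa using (hasDerivAt_id u).const_mul (Real.exp 2)
      have h := (((h0.log (by positivity)).log (by positivity)).rpow_const (p := -β)
        (Or.inl h3.ne')).const_mul (-Real.log 2 ^ β)
      refine h.congr_deriv ?_
      rw [hf, div_pow, Real.sq_sqrt hK.le, Real.sq_sqrt (hG u hu).le,
        show -β - 1 = -(1 + β) by ring, Real.rpow_neg h3.le]
      field_simp
    have hlim : Tendsto (fun u => -Real.log 2 ^ β *
        Real.log (Real.log (Real.exp 2 * u)) ^ (-β)) atTop (𝓝 0) := by
      simpa using ((tendsto_rpow_neg_atTop hβ).comp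
        (Real.tendsto_log_atTop.comp hLtop)).const_mul (-Real.log 2 ^ β)
    rw [integral_Ioi_of_hasDerivAt_of_nonneg' hderiv (fun u _ => sq_nonneg _) hlim]
    simp only [mul_one, Real.log_exp, Real.rpow_neg hlog2.le]
    field_simp
    ring
  · intro hint
    have hsmall : ∀ᶠ u : ℝ in atTop,
        Real.log (Real.log (Real.exp 2 * u)) ^ (1 + β) ≤ Real.log (Real.exp 2 * u) := by
      have h := hLtop.eventually
        ((isLittleO_log_rpow_rpow_atTop (1 + β) (zero_lt_one' ℝ)).bound zero_lt_one)
      filter_upwards [h, eventually_ge_atTop 1] with u hu h1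
      have := hL u h1
      rw [Real.rpow_one, one_mul, Real.norm_of_nonneg (zero_le_two.trans this)] at hu
      exact (le_abs_self _).trans hu
    have hsq : ∀ᶠ u : ℝ in atTop, Real.log (Real.exp 2 * u) ^ 2 ≤ Real.exp 2 * u := by
      have h := htop.eventually
        ((Real.isLittleO_pow_log_id_atTop (n := 2)).bound zero_lt_one)
      filter_upwards [h, eventually_ge_atTop 1] with u hu h1
      rw [one_mul, id, Real.norm_of_nonneg (by positivity),
        Real.norm_of_nonneg (by positivity)] at hu
      exact hu
    obtain ⟨N, hN⟩ := eventually_atTop.1 (hsmall.and hsq)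
    set C := Real.exp 1 / Real.sqrt (β * Real.log 2 ^ β) with hC
    have hintN : IntegrableOn (fun u => C * f u) (Set.Ioi (max N 1)) :=
      (hint.mono_set (Set.Ioi_subset_Ioi (le_max_right N 1))).const_mul C
    refine not_integrableOn_Ioi_inv (a := max N 1) (hintN.mono'
      measurable_inv.aestronglyMeasurable ?_)
    filter_upwards [ae_restrict_mem measurableSet_Ioi] with u hu
    obtain ⟨hNu, h1⟩ := max_lt_iff.1 (Set.mem_Ioi.1 hu)
    obtain ⟨ha, hb⟩ := hN u hNu.le
    have h2 := hL u h1.le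
    have hu0 : 0 < u := by linarith
    have hbound : Real.sqrt (u * Real.log (Real.exp 2 * u) *
        Real.log (Real.log (Real.exp 2 * u)) ^ (1 + β)) ≤ Real.exp 1 * u := by
      refine Real.sqrt_le_iff.2 ⟨by positivity, ?_⟩
      have hexp : Real.exp 2 = Real.exp 1 ^ 2 := by rw [← Real.exp_nat_mul]; norm_num
      calc _ ≤ u * Real.log (Real.exp 2 * u) * Real.log (Real.exp 2 * u) := by gcongr
        _ = u * Real.log (Real.exp 2 * u) ^ 2 := by ring
        _ ≤ u * (Real.exp 2 * u) := by gcongr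
        _ = (Real.exp 1 * u) ^ 2 := by rw [hexp]; ring
    have hs := Real.sqrt_pos.2 hK
    have hg := Real.sqrt_pos.2 (hG u h1.le)
    rw [Real.norm_of_nonneg (by positivity), hf, hC, div_mul_div_cancel₀ hs.ne',
      le_div_iff₀ hg, inv_mul_le_iff₀ hu0, mul_comm u (Real.exp 1)]
    exact hbound
end

section
/- In the K-armed bandit adaptive linear model with conditionally σ_g-sub-Gaussian noise (E[exp(λ ε_t) | F_{t-1}] ≤ exp(σ_g² λ²/2) for all λ ∈ ℝ), use the weights w_{t,k} = f(s_{t,k}/s_0) x_{t,k}/√s_0 with f(x) = √( log 2 / ( x · log(e²x) · (log log(e²x))² ) ), where s_{t,k} = s_0 + Σ_{i≤t} x_{i,k}² and s_0 > 1 is F_0-measurable. Then for any δ ∈ (0,1), on the event {s_{n,k} > s_0}, with probability at least 1 − δ, the ALEE estimator θ̂_k satisfies |θ̂_k − θ*_k| ≤ σ_g √( log(2/δ²)/log 2 ) · √(2 + log(s_{n,k}/s_0)) · log(2 + log(s_{n,k}/s_0)) / (√s_{n,k} − √s_0). -/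
open MeasureTheory ProbabilityTheory Filter Matrix Topology
open scoped RealInnerProductSpace ENNReal

section WeightBounds

/-- `L(s) = 2 + log (s / s₀)` is at least `2` for `s ≥ s₀`. -/
lemma two_le_two_add_log_div {a s : ℝ} (ha : 0 < a) (hs : a ≤ s) :
    2 ≤ 2 + Real.log (s / a) := by
  have := Real.log_nonneg ((one_le_div ha).2 hs)
  linarith

lemma log_pos_two_add_log_div {a s : ℝ} (ha : 0 < a) (hs : a ≤ s) :
    0 < Real.log (2 + Real.log (s / a)) :=
  Real.log_pos (by linarith [two_le_two_add_log_div ha hs])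

lemma log_exp_two_mul {u : ℝ} (hu : 0 < u) :
    Real.log (Real.exp 2 * u) = 2 + Real.log u := by
  rw [Real.log_mul (Real.exp_pos 2).ne' hu.ne', Real.log_exp]

/-- The increment of `-1 / log L` over a unit step dominates its derivative at the right
endpoint. -/
lemma one_div_le_inv_log_sub_inv_log {a s : ℝ} (ha : 0 < a) (hs : a ≤ s) :
    1 / ((s + 1) * (2 + Real.log ((s + 1) / a)) * Real.log (2 + Real.log ((s + 1) / a)) ^ 2) ≤
      (Real.log (2 + Real.log (s / a)))⁻¹ - (Real.log (2 + Real.log ((s + 1) / a)))⁻¹ := by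
  have hs0 : 0 < s := ha.trans_le hs
  have h1 := two_le_two_add_log_div ha hs
  have h2 := two_le_two_add_log_div ha (hs.trans (by linarith : s ≤ s + 1))
  have h3 := log_pos_two_add_log_div ha hs
  have h4 := log_pos_two_add_log_div ha (hs.trans (by linarith : s ≤ s + 1))
  have hd : 1 / (s + 1) ≤ Real.log ((s + 1) / a) - Real.log (s / a) := by
    rw [Real.log_div (by positivity) ha.ne', Real.log_div hs0.ne' ha.ne']
    have h := Real.log_le_sub_one_of_pos (x := s / (s + 1)) (by positivity)
    rw [Real.log_div hs0.ne' (by positivity)] at h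
    have : s / (s + 1) - 1 = -(1 / (s + 1)) := by field_simp; ring
    linarith
  set L := 2 + Real.log (s / a) with hL
  set L' := 2 + Real.log ((s + 1) / a) with hL'
  have hd' : 1 / (s + 1) ≤ L' - L := by linarith
  have hp : 0 < 1 / (s + 1) := by positivity
  have hLL : 1 / (s + 1) / L' ≤ Real.log L' - Real.log L := by
    have h := Real.log_le_sub_one_of_pos (x := L / L') (by positivity)
    rw [Real.log_div (by positivity) (by positivity)] at h
    have h5 : L / L' - 1 = -((L' - L) / L') := by field_simp; ring
    have h6 : 1 / (s + 1) / L' ≤ (L' - L) / L' := by gcongr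
    linarith
  have hp' : 0 < 1 / (s + 1) / L' := by positivity
  calc 1 / ((s + 1) * L' * Real.log L' ^ 2)
      = (1 / (s + 1) / L') / (Real.log L' * Real.log L') := by field_simp
    _ ≤ (Real.log L' - Real.log L) / (Real.log L * Real.log L') := by
        gcongr
        · linarith
        · linarith
    _ = (Real.log L)⁻¹ - (Real.log L')⁻¹ := by field_simp

lemma sqrt_two_mul_sqrt_succ_sub_le {s : ℝ} (hs : 1 ≤ s) :
    √2 * (√(s + 1) - √s) ≤ 1 / √(s + 1) := by
  have h1 : 0 < √(s + 1) := Real.sqrt_pos.2 (by linarith)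
  have hs0 : 0 ≤ √s := Real.sqrt_nonneg s
  have h2 : √(s + 1) ≤ √2 * √s := by
    rw [← Real.sqrt_mul (by norm_num)]
    exact Real.sqrt_le_sqrt (by linarith)
  have e1 : √(s + 1) * √(s + 1) = s + 1 := Real.mul_self_sqrt (by linarith)
  have e2 : √s * √s = s := Real.mul_self_sqrt (by linarith)
  have e3 : √2 * √2 = 2 := Real.mul_self_sqrt (by norm_num)
  rw [le_div_iff₀ h1]
  have hd : (√(s + 1) - √s) * (√(s + 1) + √s) = 1 := by nlinarith
  have hd0 : 0 ≤ √(s + 1) - √s := sub_nonneg.2 (Real.sqrt_le_sqrt (by linarith))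
  have h3 : √2 * √(s + 1) ≤ √(s + 1) + √s := by
    have h4 : √2 ≤ 3 / 2 := Real.sqrt_le_iff.2 ⟨by norm_num, by norm_num⟩
    have h5 : √(s + 1) ≤ 3 / 2 * √s := h2.trans (by gcongr)
    nlinarith
  calc √2 * (√(s + 1) - √s) * √(s + 1) = (√(s + 1) - √s) * (√2 * √(s + 1)) := by ring
    _ ≤ (√(s + 1) - √s) * (√(s + 1) + √s) := by gcongr
    _ = 1 := hd

variable {f : ℝ → ℝ}
    (hf : ∀ u, f u = Real.sqrt (Real.log 2 /
      (u * Real.log (Real.exp 2 * u) * (Real.log (Real.log (Real.exp 2 * u))) ^ 2)))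
include hf

lemma weight_eq {a s : ℝ} (ha : 0 < a) (hs : 0 < s) :
    f (s / a) / √a = √(Real.log 2 /
      (s * (2 + Real.log (s / a)) * Real.log (2 + Real.log (s / a)) ^ 2)) := by
  rw [hf, log_exp_two_mul (by positivity), ← Real.sqrt_div' _ ha.le]
  congr 1
  rw [div_div]
  congr 1
  field_simp

lemma weight_sq_le {a s : ℝ} (ha : 0 < a) (hs : a ≤ s) :
    (f ((s + 1) / a) / √a) ^ 2 ≤ Real.log 2 *
      ((Real.log (2 + Real.log (s / a)))⁻¹ - (Real.log (2 + Real.log ((s + 1) / a)))⁻¹) := by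
  have hs0 : 0 < s := ha.trans_le hs
  have h2 := two_le_two_add_log_div ha (hs.trans (by linarith : s ≤ s + 1))
  have hl : 0 < Real.log 2 := Real.log_pos (by norm_num)
  rw [weight_eq hf ha (by linarith), Real.sq_sqrt (by positivity), div_eq_mul_one_div]
  gcongr
  exact one_div_le_inv_log_sub_inv_log ha hs

lemma le_weight {a s r : ℝ} (ha : 1 < a) (hs : a ≤ s) (hr : s + 1 ≤ r) :
    √(Real.log 2) / (√(2 + Real.log (r / a)) * Real.log (2 + Real.log (r / a))) *
      (√2 * (√(s + 1) - √s)) ≤ f ((s + 1) / a) / √a := by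
  have ha0 : 0 < a := by linarith
  have h2 := two_le_two_add_log_div ha0 (hs.trans (by linarith : s ≤ s + 1))
  have h4 := log_pos_two_add_log_div ha0 (hs.trans (by linarith : s ≤ s + 1))
  have hLr : 2 + Real.log ((s + 1) / a) ≤ 2 + Real.log (r / a) := by
    gcongr
    have : 0 < s := by linarith
    positivity
  rw [weight_eq hf ha0 (by linarith)]
  set L := 2 + Real.log ((s + 1) / a)
  set R := 2 + Real.log (r / a)
  have hsp : 0 < √(s + 1) := Real.sqrt_pos.2 (by linarith)
  have hLp : 0 < √L := Real.sqrt_pos.2 (by linarith)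
  calc _ ≤ √(Real.log 2) / (√L * Real.log L) * (1 / √(s + 1)) := by
        gcongr
        · exact mul_nonneg (Real.sqrt_nonneg 2)
            (sub_nonneg.2 (Real.sqrt_le_sqrt (by linarith)))
        exact sqrt_two_mul_sqrt_succ_sub_le (by linarith : 1 ≤ s)
    _ = _ := by
        have hs1 : 0 < s + 1 := by linarith
        rw [Real.sqrt_div' _ (by positivity),
          Real.sqrt_mul' _ (by positivity), Real.sqrt_sq h4.le,
          Real.sqrt_mul hs1.le]
        field_simp

variable {a : ℝ} {b s w : ℕ → ℝ} (ha : 1 < a) (hb : ∀ t, b t = 0 ∨ b t = 1)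
    (hs : ∀ t, s t = a + ∑ i ∈ Finset.range t, b i ^ 2)
    (hw : ∀ t, w t = f (s (t + 1) / a) * b t / √a)
include ha hs

omit hf ha in
lemma partialSum_succ (t : ℕ) : s (t + 1) = s t + b t ^ 2 := by
  rw [hs, hs, Finset.sum_range_succ]; ring

omit hf ha in
lemma partialSum_mono : Monotone s :=
  monotone_nat_of_le_succ fun t => by
    rw [partialSum_succ hs t]; nlinarith [sq_nonneg (b t)]

omit hf ha in
lemma partialSum_zero : s 0 = a := by simp [hs]

include hb hw

lemma sum_weight_sq_le_one (n : ℕ) : ∑ t ∈ Finset.range n, w t ^ 2 ≤ 1 := by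
  have ha0 : 0 < a := by linarith
  have hge : ∀ t, a ≤ s t := fun t => (partialSum_zero hs).symm.trans_le
    (partialSum_mono hs (Nat.zero_le t))
  have hl : 0 < Real.log 2 := Real.log_pos (by norm_num)
  have step : ∀ t, w t ^ 2 ≤ Real.log 2 * (Real.log (2 + Real.log (s t / a)))⁻¹ -
      Real.log 2 * (Real.log (2 + Real.log (s (t + 1) / a)))⁻¹ := by
    intro t
    rw [hw, partialSum_succ hs]
    rcases hb t with h | h
    · simp [h]
    · simpa [h, mul_sub] using weight_sq_le hf ha0 (hge t)
  calc ∑ t ∈ Finset.range n, w t ^ 2 ≤ _ := Finset.sum_le_sum fun t _ => step t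
    _ = _ := Finset.sum_range_sub'
      (fun t => Real.log 2 * (Real.log (2 + Real.log (s t / a)))⁻¹) n
    _ ≤ 1 := by
      have h0 : Real.log 2 * (Real.log (2 + Real.log (s 0 / a)))⁻¹ = 1 := by
        rw [partialSum_zero hs, div_self ha0.ne']
        simp [hl.ne']
      have h1 := log_pos_two_add_log_div ha0 (hge n)
      have : 0 ≤ Real.log 2 * (Real.log (2 + Real.log (s n / a)))⁻¹ := by positivity
      simp only [h0]
      linarith

lemma le_sum_weight_mul (n : ℕ) :
    √(Real.log 2) / (√(2 + Real.log (s n / a)) * Real.log (2 + Real.log (s n / a))) *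
      (√2 * (√(s n) - √a)) ≤ ∑ t ∈ Finset.range n, w t * b t := by
  have hge : ∀ t, a ≤ s t := fun t => (partialSum_zero hs).symm.trans_le
    (partialSum_mono hs (Nat.zero_le t))
  have h := Finset.sum_range_sub (fun t => √(s t)) n
  rw [partialSum_zero hs] at h
  rw [← h, Finset.mul_sum, Finset.mul_sum]
  refine Finset.sum_le_sum fun t ht => ?_
  have hle := partialSum_mono hs (Nat.succ_le_of_lt (Finset.mem_range.1 ht))
  rw [Nat.succ_eq_add_one] at hle
  rw [hw]
  rw [partialSum_succ hs t] at hle ⊢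
  rcases hb t with hbt | hbt
  · simp [hbt]
  · simp only [hbt, one_pow, mul_one] at hle ⊢
    exact le_weight hf ha (hge t) hle

end WeightBounds

section SubGaussian

lemma exists_measurable_finite_range_tendsto {Ω : Type*} {m : MeasurableSpace Ω} {W : Ω → ℝ}
    (hW : Measurable W) :
    ∃ V : ℕ → Ω → ℝ, (∀ j, Measurable (V j)) ∧ (∀ j, (Set.range (V j)).Finite) ∧
      ∀ ω, Tendsto (fun j => V j ω) atTop (𝓝 (W ω)) :=
  ⟨fun j => hW.stronglyMeasurable.approx j, fun _ => SimpleFunc.measurable _,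
    fun _ => SimpleFunc.finite_range _, hW.stronglyMeasurable.tendsto_approx⟩

variable {Ω : Type*} {m m0 : MeasurableSpace Ω} {P : Measure Ω} [IsProbabilityMeasure P]
  {σ : ℝ} {ε : Ω → ℝ}

/-- A conditional bound on the expectation of `g` survives multiplication by a nonnegative
measurable factor. -/
lemma lintegral_mul_ofReal_le_of_condExp_le (hm : m ≤ m0) {g : Ω → ℝ} (hg0 : 0 ≤ g)
    (hgm : Measurable g) (hg : Integrable g P) {c : ℝ} (hc : ∀ᵐ ω ∂P, (P[g | m]) ω ≤ c)
    {Z : Ω → ℝ≥0∞} (hZ : Measurable[m] Z) :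
    ∫⁻ ω, Z ω * ENNReal.ofReal (g ω) ∂P ≤ ENNReal.ofReal c * ∫⁻ ω, Z ω ∂P := by
  have hle : (P.withDensity fun ω => ENNReal.ofReal (g ω)).trim hm ≤
      ENNReal.ofReal c • P.trim hm := by
    refine Measure.le_iff.2 fun A hA => ?_
    rw [Measure.smul_apply, trim_measurableSet_eq hm hA, trim_measurableSet_eq hm hA,
      withDensity_apply _ (hm A hA), ← ofReal_integral_eq_lintegral_ofReal hg.integrableOn
        (ae_of_all _ hg0), ← setIntegral_condExp hm hg hA, smul_eq_mul]
    calc ENNReal.ofReal (∫ ω in A, (P[g | m]) ω ∂P)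
        ≤ ENNReal.ofReal (∫ _ in A, c ∂P) := by
          refine ENNReal.ofReal_le_ofReal (setIntegral_mono_ae integrable_condExp.integrableOn
            (integrable_const c).integrableOn hc)
      _ = ENNReal.ofReal c * P A := by
          rw [setIntegral_const, smul_eq_mul, mul_comm, ENNReal.ofReal_mul' measureReal_nonneg,
            ofReal_measureReal]
  calc ∫⁻ ω, Z ω * ENNReal.ofReal (g ω) ∂P
      = ∫⁻ ω, Z ω ∂(P.withDensity fun ω => ENNReal.ofReal (g ω)) := by
        rw [lintegral_withDensity_eq_lintegral_mul _ hgm.ennreal_ofReal (hZ.mono hm le_rfl)]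
        simp [mul_comm]
    _ = ∫⁻ ω, Z ω ∂(P.withDensity fun ω => ENNReal.ofReal (g ω)).trim hm :=
        (lintegral_trim hm hZ).symm
    _ ≤ ∫⁻ ω, Z ω ∂(ENNReal.ofReal c • P.trim hm) := lintegral_mono' hle le_rfl
    _ = ENNReal.ofReal c * ∫⁻ ω, Z ω ∂P := by
        rw [lintegral_smul_measure, lintegral_trim hm hZ, smul_eq_mul]

variable (hm : m ≤ m0) (hεm : Measurable ε)
  (hint : ∀ lam : ℝ, Integrable (fun ω => Real.exp (lam * ε ω)) P)
  (hsub : ∀ lam : ℝ, ∀ᵐ ω ∂P,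
      (P[fun ω' => Real.exp (lam * ε ω') | m]) ω ≤ Real.exp (σ ^ 2 * lam ^ 2 / 2))
include hm hεm hint hsub

lemma lintegral_mul_exp_const_le (v : ℝ) {Z : Ω → ℝ≥0∞} (hZ : Measurable[m] Z) :
    ∫⁻ ω, Z ω * ENNReal.ofReal (Real.exp (v * ε ω - σ ^ 2 * v ^ 2 / 2)) ∂P ≤
      ∫⁻ ω, Z ω ∂P := by
  have h := lintegral_mul_ofReal_le_of_condExp_le hm (fun ω => (Real.exp_pos (v * ε ω)).le)
    (by fun_prop) (hint v) (hsub v) hZ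
  have e : ∀ ω, Z ω * ENNReal.ofReal (Real.exp (v * ε ω - σ ^ 2 * v ^ 2 / 2)) =
      ENNReal.ofReal (Real.exp (-(σ ^ 2 * v ^ 2 / 2))) *
        (Z ω * ENNReal.ofReal (Real.exp (v * ε ω))) := by
    intro ω
    rw [sub_eq_add_neg, Real.exp_add, ENNReal.ofReal_mul (Real.exp_pos _).le]
    ring
  simp_rw [e]
  rw [lintegral_const_mul' _ _ ENNReal.ofReal_ne_top]
  calc _ ≤ ENNReal.ofReal (Real.exp (-(σ ^ 2 * v ^ 2 / 2))) *
        (ENNReal.ofReal (Real.exp (σ ^ 2 * v ^ 2 / 2)) * ∫⁻ ω, Z ω ∂P) := by gcongr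
    _ = _ := by
        rw [← mul_assoc, ← ENNReal.ofReal_mul (Real.exp_pos _).le, ← Real.exp_add]
        simp

lemma lintegral_mul_exp_le_of_finite_range {W : Ω → ℝ} (hW : Measurable[m] W)
    (hfin : (Set.range W).Finite) {Z : Ω → ℝ≥0∞} (hZ : Measurable[m] Z) :
    ∫⁻ ω, Z ω * ENNReal.ofReal (Real.exp (W ω * ε ω - σ ^ 2 * W ω ^ 2 / 2)) ∂P ≤
      ∫⁻ ω, Z ω ∂P := by
  have hind : ∀ v, Measurable[m] ((W ⁻¹' {v}).indicator Z) := fun v =>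
    hZ.indicator (hW (measurableSet_singleton v))
  have split : ∀ (G : ℝ → ℝ≥0∞) ω,
      Z ω * G (W ω) = ∑ v ∈ hfin.toFinset, (W ⁻¹' {v}).indicator Z ω * G v := by
    intro G ω
    rw [Finset.sum_eq_single (W ω)]
    · simp
    · intro v _ hv
      simp [Set.indicator, hv.symm]
    · intro h
      exact absurd (hfin.mem_toFinset.2 ⟨ω, rfl⟩) h
  calc _ = ∑ v ∈ hfin.toFinset, ∫⁻ ω, (W ⁻¹' {v}).indicator Z ω *
        ENNReal.ofReal (Real.exp (v * ε ω - σ ^ 2 * v ^ 2 / 2)) ∂P := by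
        rw [← lintegral_finsetSum]
        · exact lintegral_congr fun ω => split
            (fun v => ENNReal.ofReal (Real.exp (v * ε ω - σ ^ 2 * v ^ 2 / 2))) ω
        · intro v _
          exact ((hind v).mono hm le_rfl).mul (by fun_prop)
    _ ≤ ∑ v ∈ hfin.toFinset, ∫⁻ ω, (W ⁻¹' {v}).indicator Z ω ∂P :=
        Finset.sum_le_sum fun v _ => lintegral_mul_exp_const_le hm hεm hint hsub v (hind v)
    _ = ∫⁻ ω, Z ω ∂P := by
        rw [← lintegral_finsetSum _ fun v _ => (hind v).mono hm le_rfl]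
        exact lintegral_congr fun ω => by simpa using (split 1 ω).symm

/-- One step of the exponential supermartingale, for a predictable random multiplier `W`. -/
lemma lintegral_mul_exp_le {W : Ω → ℝ} (hW : Measurable[m] W) {Z : Ω → ℝ≥0∞}
    (hZ : Measurable[m] Z) :
    ∫⁻ ω, Z ω * ENNReal.ofReal (Real.exp (W ω * ε ω - σ ^ 2 * W ω ^ 2 / 2)) ∂P ≤
      ∫⁻ ω, Z ω ∂P := by
  obtain ⟨V, hVm, hVfin, hVlim⟩ := exists_measurable_finite_range_tendsto hW
  let G : ℕ → Ω → ℝ≥0∞ := fun j ω =>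
    Z ω * ENNReal.ofReal (Real.exp (V j ω * ε ω - σ ^ 2 * V j ω ^ 2 / 2))
  have hlim : ∀ ω, Tendsto (fun j => G j ω) atTop
      (𝓝 (Z ω * ENNReal.ofReal (Real.exp (W ω * ε ω - σ ^ 2 * W ω ^ 2 / 2)))) := by
    intro ω
    have hc : Continuous fun v : ℝ => Real.exp (v * ε ω - σ ^ 2 * v ^ 2 / 2) := by fun_prop
    refine ENNReal.Tendsto.const_mul (ENNReal.tendsto_ofReal ((hc.tendsto _).comp (hVlim ω))) (.inl ?_)
    simpa using Real.exp_pos _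
  have hGm : ∀ j, Measurable (G j) := by
    intro j
    have hVj : Measurable (V j) := (hVm j).mono hm le_rfl
    exact (hZ.mono hm le_rfl).mul (by fun_prop)
  calc _ = ∫⁻ ω, liminf (fun j => G j ω) atTop ∂P :=
        lintegral_congr fun ω => (hlim ω).liminf_eq.symm
    _ ≤ liminf (fun j => ∫⁻ ω, G j ω ∂P) atTop := lintegral_liminf_le hGm
    _ ≤ liminf (fun _ : ℕ => ∫⁻ ω, Z ω ∂P) atTop := by
        refine liminf_le_liminf (Eventually.of_forall fun j => ?_)
        exact lintegral_mul_exp_le_of_finite_range hm hεm hint hsub (hVm j) (hVfin j) hZ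
    _ = _ := by simp

end SubGaussian

section Concentration

variable {Ω : Type*} {m0 : MeasurableSpace Ω} {P : Measure Ω} [IsProbabilityMeasure P]
    {F : ℕ → MeasurableSpace Ω} (hFmono : Monotone F) (hFle : ∀ t, F t ≤ m0) {σ : ℝ}
    {ε : ℕ → Ω → ℝ} (hεmeas : ∀ t, Measurable[F (t + 1)] (ε t))
    (hεint : ∀ t (lam : ℝ), Integrable (fun ω => Real.exp (lam * ε t ω)) P)
    (hsubG : ∀ t (lam : ℝ), ∀ᵐ ω ∂P,
      (P[fun ω' => Real.exp (lam * ε t ω') | F t]) ω ≤ Real.exp (σ ^ 2 * lam ^ 2 / 2))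
    {w : ℕ → Ω → ℝ} (hw : ∀ t, Measurable[F t] (w t))
include hFmono hFle hεmeas hεint hsubG hw

lemma lintegral_exp_sum_le_one (lam : ℝ) (n : ℕ) :
    ∫⁻ ω, ENNReal.ofReal (Real.exp (lam * ∑ t ∈ Finset.range n, w t ω * ε t ω -
      σ ^ 2 * lam ^ 2 / 2 * ∑ t ∈ Finset.range n, w t ω ^ 2)) ∂P ≤ 1 := by
  induction n with
  | zero => simp
  | succ n ih =>
    have hS : ∀ t ∈ Finset.range n, Measurable[F n] (w t) ∧ Measurable[F n] (ε t) := by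
      intro t ht
      have ht' := Finset.mem_range.1 ht
      exact ⟨(hw t).mono (hFmono ht'.le) le_rfl, (hεmeas t).mono (hFmono ht') le_rfl⟩
    have h1 : Measurable[F n] fun ω => ∑ t ∈ Finset.range n, w t ω * ε t ω :=
      Finset.measurable_fun_sum _ fun t ht => (hS t ht).1.mul (hS t ht).2
    have h2 : Measurable[F n] fun ω => ∑ t ∈ Finset.range n, w t ω ^ 2 :=
      Finset.measurable_fun_sum _ fun t ht => (hS t ht).1.pow_const 2
    have hZ : Measurable[F n] fun ω => ENNReal.ofReal (Real.exp
        (lam * ∑ t ∈ Finset.range n, w t ω * ε t ω -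
          σ ^ 2 * lam ^ 2 / 2 * ∑ t ∈ Finset.range n, w t ω ^ 2)) :=
      ((h1.const_mul lam).sub (h2.const_mul _)).exp.ennreal_ofReal
    refine le_trans (le_of_eq ?_) ((lintegral_mul_exp_le (hFle n)
      ((hεmeas n).mono (hFle _) le_rfl) (hεint n) (hsubG n) ((hw n).const_mul lam) hZ).trans ih)
    refine lintegral_congr fun ω => ?_
    rw [← ENNReal.ofReal_mul (Real.exp_pos _).le, ← Real.exp_add, Finset.sum_range_succ,
      Finset.sum_range_succ]
    congr 2
    ring

lemma measure_le_mul_sum_le {n : ℕ} (hw1 : ∀ ω, ∑ t ∈ Finset.range n, w t ω ^ 2 ≤ 1)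
    (lam c : ℝ) :
    P {ω | c ≤ lam * ∑ t ∈ Finset.range n, w t ω * ε t ω} ≤
      ENNReal.ofReal (Real.exp (σ ^ 2 * lam ^ 2 / 2 - c)) := by
  have hm : Measurable fun ω => ENNReal.ofReal (Real.exp
      (lam * ∑ t ∈ Finset.range n, w t ω * ε t ω -
        σ ^ 2 * lam ^ 2 / 2 * ∑ t ∈ Finset.range n, w t ω ^ 2)) := by
    have h1 : ∀ t, Measurable (w t) := fun t => (hw t).mono (hFle t) le_rfl
    have h2 : ∀ t, Measurable (ε t) := fun t => (hεmeas t).mono (hFle _) le_rfl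
    fun_prop
  have h := mul_meas_ge_le_lintegral (μ := P) hm
    (ENNReal.ofReal (Real.exp (c - σ ^ 2 * lam ^ 2 / 2)))
  have h' := h.trans
    (lintegral_exp_sum_le_one hFmono hFle hεmeas hεint hsubG hw lam n)
  rw [← neg_sub, Real.exp_neg, ENNReal.ofReal_inv_of_pos (Real.exp_pos _)]
  rw [ENNReal.le_inv_iff_mul_le, mul_comm]
  refine le_trans ?_ h'
  refine mul_le_mul' le_rfl (measure_mono fun ω hω => ?_)
  have := mul_le_mul_of_nonneg_left (hw1 ω) (by positivity : 0 ≤ σ ^ 2 * lam ^ 2 / 2)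
  simp only [Set.mem_ofPred_eq] at hω ⊢
  refine ENNReal.ofReal_le_ofReal (Real.exp_le_exp.2 ?_)
  linarith

/-- Two-sided sub-Gaussian tail bound for a predictably weighted sum with unit total weight. -/
lemma measure_lt_abs_sum_le (hσ : 0 < σ) {n : ℕ}
    (hw1 : ∀ ω, ∑ t ∈ Finset.range n, w t ω ^ 2 ≤ 1) {a : ℝ} (ha : 0 ≤ a) :
    P {ω | σ * a < |∑ t ∈ Finset.range n, w t ω * ε t ω|} ≤
      ENNReal.ofReal (2 * Real.exp (-(a ^ 2 / 2))) := by
  have key : ∀ lam : ℝ, lam ^ 2 = (a / σ) ^ 2 →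
      P {ω | a ^ 2 ≤ lam * ∑ t ∈ Finset.range n, w t ω * ε t ω} ≤
        ENNReal.ofReal (Real.exp (-(a ^ 2 / 2))) := by
    intro lam hl
    refine (measure_le_mul_sum_le hFmono hFle hεmeas hεint hsubG hw hw1 lam (a ^ 2)).trans_eq ?_
    rw [hl]
    congr 2
    field_simp
    ring
  rw [two_mul, ENNReal.ofReal_add (Real.exp_pos _).le (Real.exp_pos _).le]
  refine le_trans (measure_mono ?_) ((measure_union_le _ _).trans
    (add_le_add (key (a / σ) rfl) (key (-(a / σ)) (by ring))))
  intro ω hω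
  simp only [Set.mem_ofPred_eq, Set.mem_union] at hω ⊢
  have e : a ^ 2 = a / σ * (σ * a) := by field_simp
  have hp : 0 ≤ a / σ := by positivity
  rcases lt_abs.1 hω with h | h
  · left
    rw [e]
    exact mul_le_mul_of_nonneg_left h.le hp
  · right
    rw [e, neg_mul_comm]
    exact mul_le_mul_of_nonneg_left h.le hp

end Concentration

/-- **Remark 1, finite-sample bound for the ALEE estimator.** In the
`K`-armed bandit adaptive linear model with conditionally `σ_g`-sub-Gaussian noise
(Lean time index `t = 0,…,n−1` corresponds to the paper's `t = 1,…,n`, `F t` to the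
paper's `F_{t−1}`, and `s (t+1)` to the paper's `s_{t,k}` with `s 0 = s_0 > 1`), using the
weights `w_{t,k} = f(s_{t,k}/s₀) x_{t,k}/√s₀` with
`f(x) = √(log 2/(x log(e²x) (log log(e²x))²))`, for any `δ ∈ (0,1)`, on the event
`{s_{n,k} > s₀}`, with probability at least `1 − δ`,
`|θ̂_k − θ*_k| ≤ σ_g √(log(2/δ²)/log 2) √(2 + log(s_{n,k}/s₀)) log(2 + log(s_{n,k}/s₀))/(√s_{n,k} − √s₀)`. -/
theorem stmt8 {Ω : Type*} [m0 : MeasurableSpace Ω] (P : Measure Ω) [IsProbabilityMeasure P]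
    (n K : ℕ) (k : Fin K)
    (F : ℕ → MeasurableSpace Ω) (hFmono : Monotone F) (hFle : ∀ t, F t ≤ m0)
    (σg : ℝ) (hσg : 0 < σg)
    -- conditionally sub-Gaussian noise
    (ε : ℕ → Ω → ℝ) (hεmeas : ∀ t, Measurable[F (t + 1)] (ε t))
    (hεint : ∀ t (lam : ℝ), Integrable (fun ω => Real.exp (lam * ε t ω)) P)
    (hsubG : ∀ t (lam : ℝ), ∀ᵐ ω ∂P,
      (P[fun ω' => Real.exp (lam * ε t ω') | F t]) ω ≤ Real.exp (σg ^ 2 * lam ^ 2 / 2))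
    -- the K-armed bandit adaptive linear model
    (x : ℕ → Ω → EuclideanSpace ℝ (Fin K))
    (hxmeas : ∀ t, Measurable[F t] (x t))
    (hxbasis : ∀ t ω, ∃ j : Fin K, x t ω = EuclideanSpace.single j (1 : ℝ))
    (θstar : EuclideanSpace ℝ (Fin K))
    (y : ℕ → Ω → ℝ) (hy : ∀ t ω, y t ω = ⟪x t ω, θstar⟫ + ε t ω)
    -- the weight-generating function
    (f : ℝ → ℝ)
    (hf : ∀ u, f u = Real.sqrt (Real.log 2 /
      (u * Real.log (Real.exp 2 * u) * (Real.log (Real.log (Real.exp 2 * u))) ^ 2)))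
    -- `s₀ > 1`, the partial sums and the weights
    (s0 : Ω → ℝ) (hs0 : ∀ ω, 1 < s0 ω) (hs0meas : Measurable[F 0] s0)
    (s : ℕ → Ω → ℝ)
    (hs : ∀ t ω, s t ω = s0 ω + ∑ i ∈ Finset.range t, (x i ω k) ^ 2)
    (w : ℕ → Ω → ℝ)
    (hw : ∀ t ω, w t ω = f (s (t + 1) ω / s0 ω) * (x t ω k) / Real.sqrt (s0 ω))
    (δ : ℝ) (hδ : δ ∈ Set.Ioo (0 : ℝ) 1)
    -- the ALEE estimator of the k-th coordinate
    (θhat : Ω → ℝ)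
    (hθhat : ∀ ω, ∑ t ∈ Finset.range n, w t ω * (y t ω - x t ω k * θhat ω) = 0) :
    P ({ω | s0 ω < s n ω} \ {ω |
        |θhat ω - θstar k| ≤
          σg * Real.sqrt (Real.log (2 / δ ^ 2) / Real.log 2) *
            (Real.sqrt (2 + Real.log (s n ω / s0 ω)) *
              Real.log (2 + Real.log (s n ω / s0 ω))) /
            (Real.sqrt (s n ω) - Real.sqrt (s0 ω))})
      ≤ ENNReal.ofReal δ := by
  obtain ⟨hδ0, hδ1⟩ := hδ
  have hb : ∀ ω t, x t ω k = 0 ∨ x t ω k = 1 := by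
    intro ω t
    obtain ⟨j, hj⟩ := hxbasis t ω
    rw [hj]
    by_cases h : k = j <;> simp [h]
  have hxk : ∀ t, Measurable[F t] fun ω => x t ω k := fun t =>
    Measurable.comp (g := fun v : EuclideanSpace ℝ (Fin K) => v k) (by fun_prop) (hxmeas t)
  have hfm : Measurable f := by
    rw [funext hf]
    fun_prop
  have hs0m : ∀ t, Measurable[F t] s0 := fun t => hs0meas.mono (hFmono (Nat.zero_le t)) le_rfl
  have hsm : ∀ t, Measurable[F t] (s (t + 1)) := by
    intro t
    rw [funext (hs (t + 1))]
    refine (hs0m t).add (Finset.measurable_fun_sum _ fun i hi => ?_)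
    exact ((hxk i).mono (hFmono (Nat.lt_succ_iff.1 (Finset.mem_range.1 hi))) le_rfl).pow_const 2
  have hwm : ∀ t, Measurable[F t] (w t) := by
    intro t
    rw [funext (hw t)]
    exact ((hfm.comp ((hsm t).div (hs0m t))).mul (hxk t)).div (hs0m t).sqrt
  have hw1 : ∀ ω, ∑ t ∈ Finset.range n, w t ω ^ 2 ≤ 1 := fun ω =>
    sum_weight_sq_le_one hf (hs0 ω) (hb ω) (fun t => hs t ω) (fun t => hw t ω) n
  have hlog : 0 ≤ Real.log (2 / δ ^ 2) := by
    refine Real.log_nonneg ((one_le_div (by positivity)).2 ?_)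
    nlinarith
  have htail := measure_lt_abs_sum_le hFmono hFle hεmeas hεint hsubG hwm hσg hw1
    (Real.sqrt_nonneg (2 * Real.log (2 / δ ^ 2)))
  have hval : 2 * Real.exp (-(√(2 * Real.log (2 / δ ^ 2)) ^ 2 / 2)) ≤ δ := by
    rw [Real.sq_sqrt (by positivity), mul_div_cancel_left₀ _ two_ne_zero, Real.exp_neg,
      Real.exp_log (by positivity), inv_div, mul_div_cancel₀ _ two_ne_zero]
    nlinarith
  refine le_trans (measure_mono ?_) (htail.trans (ENNReal.ofReal_le_ofReal hval))
  rintro ω ⟨hlt, hbad⟩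
  simp only [Set.mem_ofPred_eq] at hlt hbad ⊢
  contrapose! hbad
  have hlow := le_sum_weight_mul hf (hs0 ω) (hb ω) (fun t => hs t ω) (fun t => hw t ω) n
  have herr : (∑ t ∈ Finset.range n, w t ω * x t ω k) * (θhat ω - θstar k) =
      ∑ t ∈ Finset.range n, w t ω * ε t ω := by
    have hterm : ∀ t, w t ω * (y t ω - x t ω k * θhat ω) =
        w t ω * ε t ω - w t ω * x t ω k * (θhat ω - θstar k) := by
      intro t
      obtain ⟨j, hj⟩ := hxbasis t ω
      rw [hy, hw, hj, EuclideanSpace.inner_single_left]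
      by_cases h : k = j
      · subst h; simp; ring
      · simp [h]
    have h := hθhat ω
    simp_rw [hterm] at h
    rw [Finset.sum_sub_distrib, ← Finset.sum_mul] at h
    linarith
  have ha0 : 0 < s0 ω := by linarith [hs0 ω]
  have hL2 := two_le_two_add_log_div ha0 hlt.le
  have hLp := log_pos_two_add_log_div ha0 hlt.le
  have hLs : 0 < √(2 + Real.log (s n ω / s0 ω)) := Real.sqrt_pos.2 (by linarith)
  have hl2 : 0 < √(Real.log 2) := Real.sqrt_pos.2 (Real.log_pos (by norm_num))
  have hD : 0 < √(s n ω) - √(s0 ω) := sub_pos.2 (Real.sqrt_lt_sqrt ha0.le hlt)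
  have h2 : 0 < √(2 : ℝ) := by positivity
  set B := √(2 + Real.log (s n ω / s0 ω)) * Real.log (2 + Real.log (s n ω / s0 ω))
  have hB : 0 < B := mul_pos hLs hLp
  set D := √(s n ω) - √(s0 ω)
  rw [← herr, abs_mul, Real.sqrt_mul (by norm_num)] at hbad
  have hc : 0 < √(Real.log 2) / B * (√2 * D) := by positivity
  have h3 : √(Real.log 2) / B * (√2 * D) * |θhat ω - θstar k| ≤
      σg * (√2 * √(Real.log (2 / δ ^ 2))) := by
    refine le_trans ?_ hbad
    gcongr
    exact hlow.trans (le_abs_self _)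
  rw [mul_comm, ← le_div_iff₀ hc] at h3
  refine h3.trans_eq ?_
  rw [Real.sqrt_div hlog]
  field_simp
end

section
/- Let s_0 > 1 and let x_1,…,x_n ∈ {0,1}. Set s_t = s_0 + Σ_{i=1}^t x_i² and let f(x) = √( log 2 / ( x · log(e²x) · (log log(e²x))² ) ). Then Σ_{t=1}^n f(s_t/s_0) · x_t²/√s_0 ≥ √(2 log 2) · (√s_n − √s_0) / ( √(2 + log(s_n/s_0)) · log(2 + log(s_n/s_0)) ). -/
/-- The increment of the square root over `[a, a + 1]` is at most `1 / √(2 (a + 1))` once `1 ≤ a`. -/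
theorem sqrt_two_mul_sqrt_succ_sub_sqrt_le {a : ℝ} (ha : 1 ≤ a) :
    √2 * (√(a + 1) - √a) ≤ 1 / √(a + 1) := by
  have hpos : 0 < √(a + 1) := Real.sqrt_pos.2 (by linarith)
  have hle : √a ≤ √(a + 1) := Real.sqrt_le_sqrt (by linarith)
  have hsum : √2 * √(a + 1) ≤ √(a + 1) + √a := by
    have h : √2 * √(a + 1) ≤ 2 * √a := by
      rw [← Real.sqrt_mul zero_le_two, Real.sqrt_le_left (by positivity), mul_pow,
        Real.sq_sqrt (by linarith)]
      linarith
    linarith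
  rw [le_div_iff₀ hpos]
  calc √2 * (√(a + 1) - √a) * √(a + 1) = (√(a + 1) - √a) * (√2 * √(a + 1)) := by ring
    _ ≤ (√(a + 1) - √a) * (√(a + 1) + √a) := mul_le_mul_of_nonneg_left hsum (sub_nonneg.2 hle)
    _ = √(a + 1) ^ 2 - √a ^ 2 := by ring
    _ = 1 := by
      rw [Real.sq_sqrt (by linarith), Real.sq_sqrt (by linarith)]
      ring

/-- Splitting the square root of the potential into its factors. -/
theorem sqrt_log_two_div_eq {u : ℝ} (hu : 1 ≤ u) :
    √(Real.log 2 / (u * Real.log (Real.exp 2 * u) * Real.log (Real.log (Real.exp 2 * u)) ^ 2)) =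
      √(Real.log 2) / (√u * (√(2 + Real.log u) * Real.log (2 + Real.log u))) := by
  have hu0 : 0 < u := by linarith
  have hlog : 0 ≤ Real.log u := Real.log_nonneg hu
  rw [Real.log_mul (Real.exp_ne_zero 2) hu0.ne', Real.log_exp,
    Real.sqrt_div (Real.log_nonneg one_le_two), Real.sqrt_mul (by positivity),
    Real.sqrt_mul hu0.le, Real.sqrt_sq (Real.log_nonneg (by linarith)), mul_assoc]

/-- For `s₀ > 1`, `x_t ∈ {0,1}`, `s_t = s₀ + Σ_{i≤t} x_i²` and
`f(x) = √( log 2 / (x · log(e²x) · (log log(e²x))²) )`, the deterministic lower bound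
`Σ_{t=1}^n f(s_t/s₀) x_t²/√s₀ ≥ √(2 log 2) (√s_n − √s₀) / (√(2+log(s_n/s₀)) · log(2+log(s_n/s₀)))`
holds. -/
theorem stmt9 (n : ℕ) (s0 : ℝ) (hs0 : 1 < s0)
    (x : ℕ → ℝ) (hx : ∀ t, x t = 0 ∨ x t = 1)
    (s : ℕ → ℝ) (hs : ∀ t, s t = s0 + ∑ i ∈ Finset.range t, (x i) ^ 2)
    (f : ℝ → ℝ)
    (hf : ∀ u, f u = Real.sqrt (Real.log 2 /
      (u * Real.log (Real.exp 2 * u) * (Real.log (Real.log (Real.exp 2 * u))) ^ 2))) :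
    Real.sqrt (2 * Real.log 2) * (Real.sqrt (s n) - Real.sqrt s0) /
        (Real.sqrt (2 + Real.log (s n / s0)) * Real.log (2 + Real.log (s n / s0)))
      ≤ ∑ t ∈ Finset.range n, f (s (t + 1) / s0) * (x t) ^ 2 / Real.sqrt s0 := by
  have hsucc (t : ℕ) : s (t + 1) = s t + x t ^ 2 := by
    rw [hs, hs, Finset.sum_range_succ, add_assoc]
  have hmono : Monotone s := monotone_nat_of_le_succ fun t => by
    rw [hsucc]
    linarith [sq_nonneg (x t)]
  have hs_zero : s 0 = s0 := by simp [hs]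
  have hs_ge (t : ℕ) : s0 ≤ s t := hs_zero ▸ hmono (Nat.zero_le t)
  have hs0_pos : 0 < s0 := by linarith
  have hdiv (t : ℕ) : 1 ≤ s t / s0 := (one_le_div hs0_pos).2 (hs_ge t)
  set D : ℕ → ℝ := fun t =>
    √(2 + Real.log (s t / s0)) * Real.log (2 + Real.log (s t / s0))
  have hD_pos (t : ℕ) : 0 < D t := by
    have h := Real.log_nonneg (hdiv t)
    exact mul_pos (Real.sqrt_pos.2 (by linarith)) (Real.log_pos (by linarith))
  have hD_mono {i j : ℕ} (hij : i ≤ j) : D i ≤ D j := by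
    have hi := Real.log_nonneg (hdiv i)
    have hlog : Real.log (s i / s0) ≤ Real.log (s j / s0) :=
      Real.log_le_log (by linarith [hdiv i]) (div_le_div_of_nonneg_right (hmono hij) hs0_pos.le)
    exact mul_le_mul (Real.sqrt_le_sqrt (by linarith))
      (Real.log_le_log (by linarith) (by linarith)) (Real.log_nonneg (by linarith))
      (Real.sqrt_nonneg _)
  have hterm (t : ℕ) (ht : t ∈ Finset.range n) :
      √(2 * Real.log 2) / D n * (√(s (t + 1)) - √(s t)) ≤
        f (s (t + 1) / s0) * x t ^ 2 / √s0 := by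
    rcases hx t with h | h
    · simp [hsucc, h]
    · have hst : s (t + 1) = s t + 1 := by rw [hsucc, h, one_pow]
      have hst_pos : 0 < s (t + 1) := by linarith [hs_ge (t + 1)]
      have hincr : √2 * (√(s (t + 1)) - √(s t)) ≤ 1 / √(s (t + 1)) := by
        rw [hst]
        exact sqrt_two_mul_sqrt_succ_sub_sqrt_le (by linarith [hs_ge t])
      have hf_eq : f (s (t + 1) / s0) * x t ^ 2 / √s0 =
          √(Real.log 2) / D (t + 1) * (1 / √(s (t + 1))) := by
        have hsqrt0 : √s0 ≠ 0 := (Real.sqrt_pos.2 hs0_pos).ne'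
        have hsqrt : √(s (t + 1)) ≠ 0 := (Real.sqrt_pos.2 hst_pos).ne'
        have hDne := (hD_pos (t + 1)).ne'
        rw [hf, sqrt_log_two_div_eq (hdiv (t + 1)), h, Real.sqrt_div hst_pos.le]
        change √(Real.log 2) / (√(s (t + 1)) / √s0 * D (t + 1)) * 1 ^ 2 / √s0 = _
        field_simp
      calc √(2 * Real.log 2) / D n * (√(s (t + 1)) - √(s t))
          = √(Real.log 2) / D n * (√2 * (√(s (t + 1)) - √(s t))) := by
            rw [Real.sqrt_mul zero_le_two]
            ring
        _ ≤ √(Real.log 2) / D n * (1 / √(s (t + 1))) :=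
            mul_le_mul_of_nonneg_left hincr (div_nonneg (Real.sqrt_nonneg _) (hD_pos n).le)
        _ ≤ √(Real.log 2) / D (t + 1) * (1 / √(s (t + 1))) :=
            mul_le_mul_of_nonneg_right
              (div_le_div_of_nonneg_left (Real.sqrt_nonneg _) (hD_pos (t + 1))
                (hD_mono (Finset.mem_range.1 ht))) (by positivity)
        _ = f (s (t + 1) / s0) * x t ^ 2 / √s0 := hf_eq.symm
  calc √(2 * Real.log 2) * (√(s n) - √s0) / D n
      = ∑ t ∈ Finset.range n, √(2 * Real.log 2) / D n * (√(s (t + 1)) - √(s t)) := by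
        rw [← Finset.mul_sum, Finset.sum_range_sub (fun t => √(s t)), hs_zero]
        ring
    _ ≤ _ := Finset.sum_le_sum hterm
end
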